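/- arXiv:1609.04540 — 5 statements merged into one kernel-verified Lean document; each statement's English description precedes it below -/
import Mathlib

section
/- Let (a_ν)_{ν≥0} and (b_ν)_{ν≥0} be polynomials with deg a_ν ≤ ν and deg b_ν ≤ ν, and let J(p)(x) = Σ_{ν≥0} (a_ν(x)/ν!)·p^{(ν)}(x) and K(p)(x) = Σ_{ν≥0} (b_ν(x)/ν!)·p^{(ν)}(x). Then for every polynomial p, (K∘J)(p)(x) = Σ_{n≥0} (c_n(x)/n!)·p^{(n)}(x), where c_n(x) = Σ_{μ=0}^{n} b_μ(x)·Σ_{ν=0}^{μ} C(n,ν)·a_{n−ν}^{(μ−ν)}(x)/(μ−ν)! for n ≥ 0, with C(n,ν) a binomial coefficient and a_m^{(j)} the j-th derivative of a_m. -/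
open Polynomial

/-- The operator `J(p) = Σ_{ν≥0} (a_ν(x)/ν!) p^{(ν)}(x)`. -/
noncomputable def Jop (a : ℕ → ℂ[X]) (p : ℂ[X]) : ℂ[X] :=
  ∑ ν ∈ Finset.range (p.natDegree + 1),
    (Nat.factorial ν : ℂ)⁻¹ • (a ν * derivative^[ν] p)

theorem Jop_eq_of_le (a : ℕ → ℂ[X]) (p : ℂ[X]) (N : ℕ) (h : p.natDegree ≤ N) :
    Jop a p = ∑ ν ∈ Finset.range (N + 1),
      (Nat.factorial ν : ℂ)⁻¹ • (a ν * derivative^[ν] p) := by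
  unfold Jop
  apply Finset.sum_subset
  · intro x hx
    simp only [Finset.mem_range] at *
    omega
  · intro x _ hx
    simp only [Finset.mem_range] at hx
    rw [iterate_derivative_eq_zero (by omega)]
    simp

theorem natDegree_Jop_le (a : ℕ → ℂ[X]) (ha : ∀ ν : ℕ, (a ν).degree ≤ (ν : ℕ)) (p : ℂ[X]) :
    (Jop a p).natDegree ≤ p.natDegree := by
  unfold Jop
  apply natDegree_sum_le_of_forall_le
  intro ν hν
  simp only [Finset.mem_range] at hν
  refine (natDegree_smul_le _ _).trans (natDegree_mul_le.trans ?_)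
  have h1 := natDegree_le_of_degree_le (ha ν)
  have h2 := natDegree_iterate_derivative p ν
  omega

theorem Jop_inner_sum (a : ℕ → ℂ[X]) (B p : ℂ[X]) (μ ν : ℕ) (hν : ν ≤ μ) :
    ∑ n ∈ Finset.range (p.natDegree + 1), (Nat.factorial n : ℂ)⁻¹ •
      (B * ((n.choose ν : ℂ) • ((Nat.factorial (μ - ν) : ℂ)⁻¹ •
        derivative^[μ - ν] (a (n - ν)))) * derivative^[n] p) =
    ∑ m ∈ Finset.range (p.natDegree + 1), (Nat.factorial μ : ℂ)⁻¹ • (B *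
      ((Nat.factorial m : ℂ)⁻¹ • (μ.choose ν •
        (derivative^[μ - ν] (a m) * derivative^[ν] (derivative^[m] p))))) := by
  have h1 : Finset.range (p.natDegree + 1) ⊆ Finset.range (ν + (p.natDegree + 1)) := by
    intro x hx
    simp only [Finset.mem_range] at *
    omega
  rw [Finset.sum_subset h1]
  · rw [Finset.sum_range_add, Finset.sum_eq_zero, zero_add]
    · apply Finset.sum_congr rfl
      intro m _
      rw [← Function.iterate_add_apply, Nat.add_sub_cancel_left, ← Nat.cast_smul_eq_nsmul ℂ]
      simp only [mul_smul_comm, smul_mul_assoc, smul_smul, mul_assoc]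
      congr 1
      rw [Nat.cast_choose ℂ hν, Nat.cast_choose ℂ (Nat.le_add_right ν m),
        Nat.add_sub_cancel_left]
      have e1 : (Nat.factorial μ : ℂ) ≠ 0 := by exact_mod_cast Nat.factorial_ne_zero _
      have e2 : (Nat.factorial (ν + m) : ℂ) ≠ 0 := by exact_mod_cast Nat.factorial_ne_zero _
      field_simp
    · intro n hn
      simp only [Finset.mem_range] at hn
      simp [Nat.choose_eq_zero_of_lt hn]
  · intro n _ hn
    simp only [Finset.mem_range] at hn
    rw [iterate_derivative_eq_zero (p := p) (by omega)]
    simp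

/-- the composition `K ∘ J` has the canonical expansion with coefficients
`c_n = Σ_{μ=0}^n b_μ · Σ_{ν=0}^μ C(n,ν)·a_{n−ν}^{(μ−ν)}/(μ−ν)!`. -/
theorem Jop_comp
    (a b : ℕ → ℂ[X])
    (ha : ∀ ν : ℕ, (a ν).degree ≤ (ν : ℕ)) (hb : ∀ ν : ℕ, (b ν).degree ≤ (ν : ℕ))
    (p : ℂ[X]) :
    Jop b (Jop a p) =
      Jop (fun n => ∑ μ ∈ Finset.range (n + 1), b μ *
        ∑ ν ∈ Finset.range (μ + 1), (n.choose ν : ℂ) •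
          ((Nat.factorial (μ - ν) : ℂ)⁻¹ • derivative^[μ - ν] (a (n - ν)))) p := by
  rw [Jop_eq_of_le b _ _ (natDegree_Jop_le a ha p)]
  have hL : ∀ μ, (Nat.factorial μ : ℂ)⁻¹ • (b μ * derivative^[μ] (Jop a p)) =
      ∑ ν ∈ Finset.range (μ + 1), ∑ m ∈ Finset.range (p.natDegree + 1),
        (Nat.factorial μ : ℂ)⁻¹ • (b μ * ((Nat.factorial m : ℂ)⁻¹ • (μ.choose ν •
          (derivative^[μ - ν] (a m) * derivative^[ν] (derivative^[m] p))))) := by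
    intro μ
    rw [Finset.sum_comm]
    unfold Jop
    simp only [iterate_derivative_sum, iterate_derivative_smul, iterate_derivative_mul,
      Finset.smul_sum, Finset.mul_sum]
  have hc : ∀ n ∈ Finset.range (p.natDegree + 1), (∑ μ ∈ Finset.range (n + 1), b μ *
        ∑ ν ∈ Finset.range (μ + 1), (n.choose ν : ℂ) •
          ((Nat.factorial (μ - ν) : ℂ)⁻¹ • derivative^[μ - ν] (a (n - ν)))) =
      ∑ μ ∈ Finset.range (p.natDegree + 1), b μ *
        ∑ ν ∈ Finset.range (μ + 1), (n.choose ν : ℂ) •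
          ((Nat.factorial (μ - ν) : ℂ)⁻¹ • derivative^[μ - ν] (a (n - ν))) := by
    intro n hn
    apply Finset.sum_subset
    · intro x hx
      simp only [Finset.mem_range] at *
      omega
    · intro μ _ hμ
      simp only [Finset.mem_range] at hμ
      rw [Finset.sum_eq_zero, mul_zero]
      intro ν hν
      by_cases h : n < ν
      · simp [Nat.choose_eq_zero_of_lt h]
      · have h1 := natDegree_le_of_degree_le (ha (n - ν))
        rw [iterate_derivative_eq_zero (by omega)]
        simp
  simp only [hL]
  unfold Jop
  refine Eq.trans ?_ (Finset.sum_congr rfl (fun n hn =>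
    congrArg (fun q => (Nat.factorial n : ℂ)⁻¹ • (q * derivative^[n] p)) (hc n hn).symm))
  simp only [Finset.mul_sum, Finset.sum_mul, Finset.smul_sum]
  rw [Finset.sum_comm (s := Finset.range (p.natDegree + 1))
    (t := Finset.range (p.natDegree + 1))]
  apply Finset.sum_congr rfl
  intro μ _
  rw [Finset.sum_comm (s := Finset.range (p.natDegree + 1))]
  apply Finset.sum_congr rfl
  intro ν hν
  simp only [Finset.mem_range] at hν
  exact (Jop_inner_sum a (b μ) p μ ν (by omega)).symm
end

section
/- Let (a_ν)_{ν≥0} be polynomials with deg a_ν ≤ ν, J(p)(x) = Σ_{ν≥0} (a_ν(x)/ν!)·p^{(ν)}(x), and assume λ_n^{[0]} := Σ_{μ=0}^{n} C(n,μ)·a_μ^{[μ]} ≠ 0 for all n ≥ 0, so that J is an isomorphism of ℂ[x]. Let (ã_n)_{n≥0} be the unique polynomials with deg ã_n ≤ n such that J^{-1}(p)(x) = Σ_{n≥0} (ã_n(x)/n!)·p^{(n)}(x). Then ã_0(x) = (λ_0^{[0]})^{-1} = (a_0^{[0]})^{-1}, and for every n ≥ 0: λ_{n+1}^{[0]}·ã_{n+1}(x)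 = − Σ_{μ=0}^{n} ã_μ(x)·Σ_{ν=0}^{μ} C(n+1,ν)·a_{n+1−ν}^{(μ−ν)}(x)/(μ−ν)!. -/
open Polynomial

theorem hasse_eq_smul (k : ℕ) (p : ℂ[X]) :
    (Nat.factorial k : ℂ)⁻¹ • derivative^[k] p = hasseDeriv k p := by
  have h : k.factorial • hasseDeriv k p = derivative^[k] p := by
    rw [← factorial_smul_hasseDeriv]; rfl
  rw [← h, ← Nat.cast_smul_eq_nsmul ℂ, smul_smul, inv_mul_cancel₀, one_smul]
  exact_mod_cast Nat.factorial_ne_zero k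

theorem Jop_eq (a : ℕ → ℂ[X]) (p : ℂ[X]) (N : ℕ) (hN : p.natDegree ≤ N) :
    Jop a p = ∑ ν ∈ Finset.range (N + 1), a ν * hasseDeriv ν p := by
  unfold Jop
  simp_rw [← mul_smul_comm, hasse_eq_smul]
  apply Finset.sum_subset
  · intro x; simp only [Finset.mem_range]; omega
  · intro x _ hx
    simp only [Finset.mem_range] at hx
    rw [hasseDeriv_eq_zero_of_lt_natDegree _ _ (by omega), mul_zero]

theorem hasse_pow (t : ℂ) (N ν : ℕ) :
    hasseDeriv ν ((X - C t) ^ N) = (N.choose ν : ℂ) • (X - C t) ^ (N - ν) := by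
  rw [← hasse_eq_smul, iterate_derivative_X_sub_pow, Nat.descFactorial_eq_factorial_mul_choose,
    ← Nat.cast_smul_eq_nsmul ℂ, smul_smul]
  congr 1
  have : (Nat.factorial ν : ℂ) ≠ 0 := by exact_mod_cast Nat.factorial_ne_zero ν
  push_cast
  field_simp

theorem natDegree_Jpow (a : ℕ → ℂ[X]) (ha : ∀ ν : ℕ, (a ν).degree ≤ (ν : ℕ)) (t : ℂ) (N : ℕ) :
    (∑ ν ∈ Finset.range (N + 1), a ν * ((N.choose ν : ℂ) • (X - C t) ^ (N - ν))).natDegree ≤ N := by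
  apply natDegree_sum_le_of_forall_le
  intro ν hν
  simp only [Finset.mem_range] at hν
  have h1 : (a ν).natDegree ≤ ν := natDegree_le_of_degree_le (ha ν)
  have h2 : ((N.choose ν : ℂ) • (X - C t) ^ (N - ν)).natDegree ≤ N - ν := by
    refine (natDegree_smul_le _ _).trans ?_
    rw [natDegree_pow, natDegree_X_sub_C, mul_one]
  refine natDegree_mul_le.trans ?_
  omega

theorem eval_hasse_Jpow (a : ℕ → ℂ[X]) (t : ℂ) (N μ : ℕ) (hμ : μ ≤ N) :
    (hasseDeriv μ (∑ ν ∈ Finset.range (N + 1),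
      a ν * ((N.choose ν : ℂ) • (X - C t) ^ (N - ν)))).eval t =
    ∑ k ∈ Finset.range (μ + 1), (N.choose k : ℂ) * (hasseDeriv (μ - k) (a (N - k))).eval t := by
  rw [← Finset.sum_range_reflect, ← taylor_coeff, map_sum, finsetSum_coeff]
  symm
  refine Finset.sum_subset_zero_on_sdiff (fun x => ?_) ?_ ?_
  · simp only [Finset.mem_range]; omega
  · intro k hk
    simp only [Finset.mem_sdiff, Finset.mem_range] at hk
    have e : N - (N + 1 - 1 - k) = k := by omega
    rw [e, mul_smul_comm, map_smul, taylor_mul, taylor_pow]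
    simp only [map_sub, taylor_X, taylor_C, add_sub_cancel_right, coeff_smul]
    rw [coeff_mul_X_pow', if_neg (by omega), smul_zero]
  · intro k hk
    simp only [Finset.mem_range] at hk
    have e : N - (N + 1 - 1 - k) = k := by omega
    have e2 : N + 1 - 1 - k = N - k := by omega
    rw [e, e2, mul_smul_comm, map_smul, taylor_mul, taylor_pow]
    simp only [map_sub, taylor_X, taylor_C, add_sub_cancel_right, coeff_smul]
    rw [coeff_mul_X_pow', if_pos (by omega), taylor_coeff, smul_eq_mul,
      Nat.choose_symm (by omega)]

theorem key (a aInv : ℕ → ℂ[X]) (ha : ∀ ν : ℕ, (a ν).degree ≤ (ν : ℕ))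
    (hinv : ∀ p : ℂ[X], Jop aInv (Jop a p) = p) (N : ℕ) :
    ∑ μ ∈ Finset.range (N + 1), aInv μ *
      ∑ k ∈ Finset.range (μ + 1), (N.choose k : ℂ) • hasseDeriv (μ - k) (a (N - k)) = 0 ^ N := by
  apply Polynomial.funext
  intro t
  have h := congrArg (eval t) (hinv ((X - C t) ^ N))
  have hd : ((X - C t) ^ N).natDegree ≤ N := by
    rw [natDegree_pow, natDegree_X_sub_C, mul_one]
  rw [Jop_eq a _ N hd] at h
  simp_rw [hasse_pow] at h
  rw [Jop_eq aInv _ N (natDegree_Jpow a ha t N), eval_finsetSum] at h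
  rw [eval_finsetSum]
  simp only [eval_pow, eval_sub, eval_X, eval_C, sub_self, eval_zero] at h ⊢
  rw [← h]
  refine Finset.sum_congr rfl fun μ hμ => ?_
  simp only [Finset.mem_range] at hμ
  rw [eval_mul, eval_mul, eval_hasse_Jpow a t N μ (by omega), eval_finsetSum]
  simp

theorem hasse_top (a : ℕ → ℂ[X]) (ha : ∀ ν : ℕ, (a ν).degree ≤ (ν : ℕ)) (m : ℕ) :
    hasseDeriv m (a m) = C ((a m).coeff m) := by
  have h1 : (a m).natDegree ≤ m := natDegree_le_of_degree_le (ha m)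
  ext j
  rw [hasseDeriv_coeff, coeff_C]
  split_ifs with hj
  · subst hj; simp
  · rw [coeff_eq_zero_of_natDegree_lt (by omega), mul_zero]

theorem top_sum (a : ℕ → ℂ[X]) (ha : ∀ ν : ℕ, (a ν).degree ≤ (ν : ℕ)) (N : ℕ) :
    ∑ k ∈ Finset.range (N + 1), (N.choose k : ℂ) • hasseDeriv (N - k) (a (N - k)) =
    C (∑ μ ∈ Finset.range (N + 1), (N.choose μ : ℂ) * (a μ).coeff μ) := by
  rw [← Finset.sum_range_reflect, map_sum]
  refine Finset.sum_congr rfl fun k hk => ?_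
  simp only [Finset.mem_range] at hk
  have e : N - (N + 1 - 1 - k) = k := by omega
  have e2 : N + 1 - 1 - k = N - k := by omega
  rw [e, e2, hasse_top a ha, Nat.choose_symm (by omega), smul_C, smul_eq_mul]

/-- recursive formula for the coefficient sequence of the inverse isomorphism
`J^{-1} = Σ_{n≥0} (aInv_n(x)/n!) D^n`:
`aInv_0 = (λ_0^{[0]})⁻¹ = (a_0^{[0]})⁻¹`, and
`λ_{n+1}^{[0]} aInv_{n+1} = − Σ_{μ=0}^n aInv_μ Σ_{ν=0}^μ C(n+1,ν)·a_{n+1−ν}^{(μ−ν)}/(μ−ν)!`. -/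
theorem Jop_inverse_coeffs
    (a aInv : ℕ → ℂ[X])
    (ha : ∀ ν : ℕ, (a ν).degree ≤ (ν : ℕ)) (haInv : ∀ n : ℕ, (aInv n).degree ≤ (n : ℕ))
    (hlam : ∀ n : ℕ, (∑ μ ∈ Finset.range (n + 1), (n.choose μ : ℂ) * (a μ).coeff μ) ≠ 0)
    (hinv : ∀ p : ℂ[X], Jop aInv (Jop a p) = p ∧ Jop a (Jop aInv p) = p) :
    aInv 0 = C ((a 0).coeff 0)⁻¹ ∧
    ∀ n : ℕ,
      (∑ μ ∈ Finset.range (n + 2), ((n + 1).choose μ : ℂ) * (a μ).coeff μ) • aInv (n + 1) =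
      - ∑ μ ∈ Finset.range (n + 1), aInv μ *
          ∑ ν ∈ Finset.range (μ + 1), ((n + 1).choose ν : ℂ) •
            ((Nat.factorial (μ - ν) : ℂ)⁻¹ • derivative^[μ - ν] (a (n + 1 - ν))) := by
  have hk := key a aInv ha (fun p => (hinv p).1)
  have hn : ∀ N, (∑ μ ∈ Finset.range (N + 1), (N.choose μ : ℂ) * (a μ).coeff μ) • aInv N +
      ∑ μ ∈ Finset.range N, aInv μ *
      ∑ k ∈ Finset.range (μ + 1), (N.choose k : ℂ) • hasseDeriv (μ - k) (a (N - k)) = 0 ^ N := by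
    intro N
    have h := hk N
    rw [Finset.sum_range_succ, top_sum a ha] at h
    rw [← h, smul_eq_C_mul]
    ring
  constructor
  · have h0 := hn 0
    have hl := hlam 0
    simp only [zero_add, Finset.sum_range_one, Nat.choose_self, Nat.cast_one, one_mul,
      Finset.range_zero, Finset.sum_empty, add_zero, pow_zero] at h0 hl
    have h1 := congrArg (fun p => ((a 0).coeff 0)⁻¹ • p) h0
    simp only [smul_smul, inv_mul_cancel₀ hl, one_smul] at h1
    rw [h1, smul_eq_C_mul, mul_one]
  · intro n
    simp_rw [hasse_eq_smul]
    have := hn (n + 1)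
    rw [zero_pow (Nat.succ_ne_zero n)] at this
    exact eq_neg_of_add_eq_zero_left this
end

section
/- Let k ≥ 0 be an integer, (a_ν)_{ν≥0} polynomials with deg a_ν ≤ ν, and J(p)(x) = Σ_{ν≥0} (a_ν(x)/ν!)·p^{(ν)}(x). Then the following two sets of conditions are equivalent: (I) J(x^i) = 0 for 0 ≤ i ≤ k−1 (when k ≥ 1), J(x^k) is the nonzero constant a_0^{[k]}, and deg J(x^{n+k}) = n for all n ≥ 0; (II) (a) a_0 = a_1 = ⋯ = a_{k−1} = 0 (when k ≥ 1); (b) deg a_ν ≤ ν − k for all ν ≥ k; (c) λ_{n+k}^{[k]} := Σ_{ν=0}^{n} C(n+k, n+k−ν)·a_{n−ν}^{[n+k−ν]} ≠ 0 for all n ≥ 0. -/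
open Polynomial

lemma Jop_X_pow (a : ℕ → ℂ[X]) (m : ℕ) :
    Jop a (X ^ m) = ∑ ν ∈ Finset.range (m + 1), C (m.choose ν : ℂ) * (a ν * X ^ (m - ν)) := by
  unfold Jop
  rw [natDegree_X_pow]
  refine Finset.sum_congr rfl fun ν _ => ?_
  rw [iterate_derivative_X_pow_eq_natCast_mul, smul_eq_C_mul,
    Nat.descFactorial_eq_factorial_mul_choose]
  have h : (C ((Nat.factorial ν : ℂ)⁻¹) : ℂ[X]) * (Nat.factorial ν : ℂ[X]) = 1 := by
    rw [← C_eq_natCast, ← C_mul, inv_mul_cancel₀ (by exact_mod_cast Nat.factorial_ne_zero ν), C_1]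
  have h2 : (C (m.choose ν : ℂ) : ℂ[X]) = (m.choose ν : ℂ[X]) := C_eq_natCast _
  rw [h2]
  push_cast
  linear_combination ((m.choose ν : ℂ[X]) * a ν * X ^ (m - ν)) * h

lemma Jop_coeff (a : ℕ → ℂ[X]) (n k : ℕ) :
    (Jop a (X ^ (n + k))).coeff n = ∑ ν ∈ Finset.range (n + 1),
        ((n + k).choose (n + k - ν) : ℂ) * (a (n + k - ν)).coeff (n - ν) := by
  rw [Jop_X_pow, ← Finset.sum_range_reflect, finsetSum_coeff]
  have hs : Finset.range (n + 1) ⊆ Finset.range (n + k + 1) := by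
    intro x; simp only [Finset.mem_range]; omega
  rw [← Finset.sum_subset hs]
  · refine Finset.sum_congr rfl fun ν hν => ?_
    have hν' : ν ≤ n := by simp only [Finset.mem_range] at hν; omega
    have e1 : n + k + 1 - 1 - ν = n + k - ν := by omega
    have e2 : n + k - (n + k - ν) = ν := by omega
    rw [e1, e2, coeff_C_mul, coeff_mul_X_pow', if_pos hν']
  · intro ν h1 h2
    simp only [Finset.mem_range] at h1 h2
    rw [coeff_C_mul, coeff_mul_X_pow', if_neg (by omega), mul_zero]

lemma term_degree_le (p : ℂ[X]) (c : ℂ) (k ν m : ℕ) (hk : k ≤ ν) (hm : ν ≤ m)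
    (h : p.degree ≤ ((ν - k : ℕ) : WithBot ℕ)) :
    (C c * (p * X ^ (m - ν))).degree ≤ ((m - k : ℕ) : WithBot ℕ) := by
  rw [← natDegree_le_iff_degree_le] at h ⊢
  have h1 := natDegree_C_mul_le c (p * X ^ (m - ν))
  have h2 := natDegree_mul_le (p := p) (q := X ^ (m - ν))
  rw [natDegree_X_pow] at h2
  omega

/-- characterization of lowering operators of order `k`:
conditions (I) `J(x^i)=0` for `i<k`, `J(x^k)=a_0^{[k]} ≠ 0`, `deg J(x^{n+k}) = n`,
are equivalent to (II) `a_0=⋯=a_{k−1}=0`, `deg a_ν ≤ ν−k` for `ν ≥ k`, and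
`λ_{n+k}^{[k]} = Σ_{ν=0}^n C(n+k,n+k−ν)·a_{n−ν}^{[n+k−ν]} ≠ 0`. -/
theorem lowering_operator_iff
    (k : ℕ) (a : ℕ → ℂ[X]) (ha : ∀ ν : ℕ, (a ν).degree ≤ (ν : ℕ)) :
    ((∀ i : ℕ, i < k → Jop a (X ^ i) = 0) ∧
      Jop a (X ^ k) = C ((a k).coeff 0) ∧ (a k).coeff 0 ≠ 0 ∧
      ∀ n : ℕ, (Jop a (X ^ (n + k))).degree = (n : ℕ)) ↔
    ((∀ ν : ℕ, ν < k → a ν = 0) ∧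
      (∀ ν : ℕ, k ≤ ν → (a ν).degree ≤ ((ν - k : ℕ) : WithBot ℕ)) ∧
      ∀ n : ℕ, (∑ ν ∈ Finset.range (n + 1),
        ((n + k).choose (n + k - ν) : ℂ) * (a (n + k - ν)).coeff (n - ν)) ≠ 0) := by
  have hsucc : ∀ m, Jop a (X ^ m) =
      (∑ ν ∈ Finset.range m, C (m.choose ν : ℂ) * (a ν * X ^ (m - ν))) + a m := by
    intro m
    rw [Jop_X_pow, Finset.sum_range_succ]
    simp
  constructor
  · rintro ⟨h1, -, -, h4⟩
    have hA : ∀ ν : ℕ, ν < k → a ν = 0 := by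
      intro ν
      induction ν using Nat.strong_induction_on with
      | _ ν ih =>
        intro hν
        have := hsucc ν
        rw [h1 ν hν, Finset.sum_eq_zero, zero_add] at this
        · exact this.symm
        · intro j hj
          have hj' := Finset.mem_range.1 hj
          rw [ih j hj' (by omega)]; simp
    refine ⟨hA, ?_, ?_⟩
    · intro ν
      induction ν using Nat.strong_induction_on with
      | _ ν ih =>
        intro hν
        have e : a ν = Jop a (X ^ ν) -
            ∑ j ∈ Finset.range ν, C (ν.choose j : ℂ) * (a j * X ^ (ν - j)) := by
          rw [hsucc ν]; ring
        rw [e]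
        refine (degree_sub_le _ _).trans (max_le ?_ ?_)
        · have := h4 (ν - k)
          rw [Nat.sub_add_cancel hν] at this
          exact this.le
        · refine (degree_sum_le _ _).trans (Finset.sup_le fun j hj => ?_)
          have hj' := Finset.mem_range.1 hj
          by_cases hjk : j < k
          · rw [hA j hjk]; simp
          · exact term_degree_le _ _ k j ν (by omega) hj'.le (ih j hj' (by omega))
    · intro n
      rw [← Jop_coeff]
      exact coeff_ne_zero_of_eq_degree (h4 n)
  · rintro ⟨hA, hB, hC⟩
    have hk : Jop a (X ^ k) = a k := by
      rw [hsucc, Finset.sum_eq_zero, zero_add]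
      intro j hj
      rw [hA j (Finset.mem_range.1 hj)]; simp
    refine ⟨?_, ?_, ?_, ?_⟩
    · intro i hi
      rw [Jop_X_pow]
      refine Finset.sum_eq_zero fun j hj => ?_
      have hj' := Finset.mem_range.1 hj
      rw [hA j (by omega)]; simp
    · rw [hk]
      refine eq_C_of_degree_le_zero ?_
      simpa using hB k le_rfl
    · simpa using hC 0
    · intro n
      refine le_antisymm ?_ (le_degree_of_ne_zero (by rw [Jop_coeff]; exact hC n))
      rw [Jop_X_pow]
      refine (degree_sum_le _ _).trans (Finset.sup_le fun j hj => ?_)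
      have hj' := Finset.mem_range.1 hj
      by_cases hjk : j < k
      · rw [hA j hjk]; simp
      · have := term_degree_le (a j) ((n + k).choose j : ℂ) k j (n + k) (by omega) (by omega)
          (hB j (by omega))
        rwa [Nat.add_sub_cancel] at this
end

section
/- Let k ≥ 0 be an integer and let J be a lowering operator of order k with coefficient polynomials (a_ν) and constants λ_{n+k}^{[k]}. Let (P_n)_{n≥0} be a monic polynomial sequence with dual sequence (u_n)_{n≥0}, and define P̃_n(x) = (λ_{n+k}^{[k]})^{-1}·J(P_{n+k})(x) for n ≥ 0. Then P̃_n = P_n for every n ≥ 0 if and only if ^tJ(u_n) = λ_{n+k}^{[k]}·u_{n+k} for every n ≥ 0, where ^tJ is the transpose of J on linear functionals, ⟨^tJ(u), p⟩ = ⟨u, J(p)⟩. -/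
open Polynomial

/-- The constants `λ_{n+k}^{[k]} = Σ_{ν=0}^n C(n+k, n+k−ν)·a_{n−ν}^{[n+k−ν]}`. -/
noncomputable def lamJ (k : ℕ) (a : ℕ → ℂ[X]) (n : ℕ) : ℂ :=
  ∑ ν ∈ Finset.range (n + 1),
    ((n + k).choose (n + k - ν) : ℂ) * (a (n + k - ν)).coeff (n - ν)

lemma Jop_eq_of_lt (a : ℕ → ℂ[X]) (p : ℂ[X]) (N : ℕ) (h : p.natDegree < N) :
    Jop a p = ∑ ν ∈ Finset.range N, (Nat.factorial ν : ℂ)⁻¹ • (a ν * derivative^[ν] p) := by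
  unfold Jop
  apply Finset.sum_subset
  · intro x hx
    simp only [Finset.mem_range] at *
    omega
  · intro x _ hx
    simp only [Finset.mem_range] at hx
    rw [iterate_derivative_eq_zero (by omega)]
    simp

lemma Jop_add (a : ℕ → ℂ[X]) (p q : ℂ[X]) : Jop a (p + q) = Jop a p + Jop a q := by
  have h := natDegree_add_le p q
  rw [Jop_eq_of_lt a (p + q) (max p.natDegree q.natDegree + 1) (by omega),
    Jop_eq_of_lt a p (max p.natDegree q.natDegree + 1) (by omega),
    Jop_eq_of_lt a q (max p.natDegree q.natDegree + 1) (by omega), ← Finset.sum_add_distrib]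
  refine Finset.sum_congr rfl fun ν _ => ?_
  rw [iterate_map_add, mul_add, smul_add]

lemma Jop_smul (a : ℕ → ℂ[X]) (c : ℂ) (p : ℂ[X]) : Jop a (c • p) = c • Jop a p := by
  have h := natDegree_smul_le c p
  rw [Jop_eq_of_lt a (c • p) (p.natDegree + 1) (by omega), Jop, Finset.smul_sum]
  refine Finset.sum_congr rfl fun ν _ => ?_
  rw [iterate_derivative_smul, mul_smul_comm, smul_comm]

noncomputable def JopLin (a : ℕ → ℂ[X]) : ℂ[X] →ₗ[ℂ] ℂ[X] where
  toFun := Jop a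
  map_add' := Jop_add a
  map_smul' := Jop_smul a

/-- for a lowering operator `J` of order `k` and a MPS `(P_n)` with dual
sequence `(u_n)`, setting `P̃_n = (λ_{n+k}^{[k]})⁻¹ J(P_{n+k})`, one has
`P̃_n = P_n` for all `n` iff `^tJ(u_n) = λ_{n+k}^{[k]}·u_{n+k}` for all `n`
(i.e. `⟨u_n, J(p)⟩ = λ_{n+k}^{[k]}·⟨u_{n+k}, p⟩` for every polynomial `p`). -/
theorem Jimage_fixed_iff_dual_shift
    (k : ℕ) (a : ℕ → ℂ[X])
    (ha0 : ∀ ν : ℕ, ν < k → a ν = 0)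
    (ha1 : ∀ ν : ℕ, k ≤ ν → (a ν).degree ≤ ((ν - k : ℕ) : WithBot ℕ))
    (hlam : ∀ n : ℕ, lamJ k a n ≠ 0)
    (P : ℕ → ℂ[X]) (hPmonic : ∀ n, (P n).Monic) (hPdeg : ∀ n, (P n).natDegree = n)
    (u : ℕ → Module.Dual ℂ ℂ[X])
    (hu : ∀ n m : ℕ, u n (P m) = if n = m then 1 else 0)
    (Pt : ℕ → ℂ[X]) (hPt : ∀ n : ℕ, Pt n = (lamJ k a n)⁻¹ • Jop a (P (n + k))) :
    (∀ n : ℕ, Pt n = P n) ↔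
      ∀ (n : ℕ) (p : ℂ[X]), u n (Jop a p) = lamJ k a n * u (n + k) p := by
  classical
  let S : Polynomial.Sequence ℂ := ⟨P, fun i => by
    rw [degree_eq_natDegree (hPmonic i).ne_zero, hPdeg]⟩
  let B : Module.Basis ℕ ℂ ℂ[X] := S.basis (fun i => by
    have : (P i).leadingCoeff = 1 := hPmonic i
    change IsUnit (P i).leadingCoeff
    simp [this])
  have hB : ∀ i, B i = P i := fun i => by
    simp only [B, Polynomial.Sequence.basis_eq_self]
    rfl
  have hrepr : ∀ i q, B.repr q i = u i q := by
    intro i q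
    have : B.coord i = u i := by
      apply B.ext
      intro j
      rw [hB j, hu, ← hB j, Module.Basis.coord_apply, Module.Basis.repr_self,
        Finsupp.single_apply]
      simp only [eq_comm]
    rw [← this, Module.Basis.coord_apply]
  constructor
  · intro h n p
    have key : (u n).comp (JopLin a) = lamJ k a n • u (n + k) := by
      apply B.ext
      intro m
      rw [hB]
      change u n (Jop a (P m)) = lamJ k a n * u (n + k) (P m)
      by_cases hm : m < k
      · have : Jop a (P m) = 0 := by
          unfold Jop
          apply Finset.sum_eq_zero
          intro ν hν
          rw [Finset.mem_range, hPdeg] at hν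
          rw [ha0 ν (by omega)]
          simp
        rw [this, hu, if_neg (by omega)]
        simp
      · obtain ⟨j, rfl⟩ : ∃ j, m = j + k := ⟨m - k, by omega⟩
        have hJ : Jop a (P (j + k)) = lamJ k a j • P j := by
          rw [← h j, hPt, smul_smul, mul_inv_cancel₀ (hlam j), one_smul]
        rw [hJ, map_smul, hu, hu]
        by_cases hnj : n = j
        · subst hnj
          simp
        · simp [hnj]
    exact LinearMap.congr_fun key p
  · intro h n
    apply B.repr.injective
    ext m
    rw [hrepr, hrepr, hPt, map_smul, h, hu, hu]
    by_cases hnm : m = n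
    · subst hnm
      simp [hlam]
    · simp [hnm]
end

section
/- Let (P_n)_{n≥0} be a two-orthogonal monic polynomial sequence with structure coefficients (β_n)_{n≥0}, (α_n)_{n≥1}, (γ_n)_{n≥1} (γ_{n+1} ≠ 0 for all n ≥ 0), with dual sequence (u_n)_{n≥0} satisfying x·u_n = u_{n−1} + β_n·u_n + α_{n+1}·u_{n+1} + γ_{n+1}·u_{n+2} for n ≥ 0 (u_{−1} = 0). Let a_0^{[1]}, a_0^{[2]}, a_1^{[2]} ∈ ℂ, set a_2(x) = a_0^{[2]} + a_1^{[2]}x, J = a_0^{[1]}D + (a_2(x)/2)D², and assume λ_{n+1}^{[1]} := (n+1)a_0^{[1]} + (n(n+1)/2)·a_1^{[2]} ≠ 0 for all n ≥ 0 and J(P_{n+1}) = λ_{n+1}^{[1]}·P_n for every n ≥ 0. Define E_1(x) = (x−β_0)/γ_1, A_0(x) = −α_1/γ_1, B_1(x) = −(α_2/(γ_1γ_2))(x−β_0) − 1/γ_2, F_1(x) = (1/γ_2)(x − β_1 + α_2α_1/γ_1), E_2(x) = (1/γ_3)((x−β_2)E_1(x) − α_3B_1(x)), A_1(x) = −(1/γ_3)(α_3F_1(x)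 + 1 + (α_1/γ_1)(x−β_2)), and φ_{1,1}(x) = 1/2 − (α_1λ_2^{[1]}/(2λ_1^{[1]}))E_1(x) − (γ_1λ_3^{[1]}/(2λ_1^{[1]}))B_1(x), φ_{1,2}(x) = (x−β_0)/2 − (α_1λ_2^{[1]}/(2λ_1^{[1]}))A_0(x) − (γ_1λ_3^{[1]}/(2λ_1^{[1]}))F_1(x), φ_{2,1}(x) = (x−β_1)E_1(x) − (α_2λ_3^{[1]}/λ_2^{[1]})B_1(x) − (γ_2λ_4^{[1]}/λ_2^{[1]})E_2(x), φ_{2,2}(x) = (x−β_1)A_0(x) − (α_2λ_3^{[1]}/λ_2^{[1]})F_1(x) − (γ_2λ_4^{[1]}/λ_2^{[1]})A_1(x). Then the pair (u_0, u_1) satisfies the two functional equations: D(φ_{1,1}·u_0 + φ_{1,2}·u_1) + u_1 = 0 and D(φ_{2,1}·u_0 + φ_{2,2}·u_1) + (2/γ_1)(x−β_0)·u_0 − (2α_1/γ_1)·u_1 = 0. -/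
open Polynomial

/-- Left multiplication of a linear functional by a polynomial: `⟨fu,p⟩ = ⟨u,fp⟩`. -/
noncomputable def lmulD (f : ℂ[X]) (u : Module.Dual ℂ ℂ[X]) : Module.Dual ℂ ℂ[X] :=
  u ∘ₗ LinearMap.mulLeft ℂ f

/-- Derivative of a linear functional: `⟨Du,p⟩ = −⟨u,p'⟩`. -/
noncomputable def derD (u : Module.Dual ℂ ℂ[X]) : Module.Dual ℂ ℂ[X] :=
  - (u ∘ₗ (derivative : ℂ[X] →ₗ[ℂ] ℂ[X]))

/-- The constants `λ_m^{[1]} = m·a_0^{[1]} + (m(m−1)/2)·a_1^{[2]}` (so that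
`λ_{n+1}^{[1]} = (n+1)a_0^{[1]} + (n(n+1)/2)a_1^{[2]}`). -/
noncomputable def lam1 (c1 c12 : ℂ) (m : ℕ) : ℂ :=
  (m : ℂ) * c1 + ((m : ℂ) * ((m : ℂ) - 1) / 2) * c12

/-- A linear functional is determined by its values on a two-orthogonal sequence. -/
lemma aux_ext (β α γ : ℕ → ℂ) (P : ℕ → ℂ[X])
    (hP0 : P 0 = 1) (hP1 : P 1 = X - C (β 0))
    (hP2 : P 2 = (X - C (β 1)) * (P 1) - C (α 1))
    (hPrec : ∀ n : ℕ, P (n + 3) =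
      (X - C (β (n + 2))) * P (n + 2) - C (α (n + 2)) * P (n + 1) - C (γ (n + 1)) * P n)
    (f g : Module.Dual ℂ ℂ[X]) (h : ∀ n, f (P n) = g (P n)) (p : ℂ[X]) : f p = g p := by
  have hX : ∀ n, X * P n ∈ Submodule.span ℂ (Set.range P) := by
    have hm : ∀ n, P n ∈ Submodule.span ℂ (Set.range P) :=
      fun n => Submodule.subset_span ⟨n, rfl⟩
    intro n
    match n with
    | 0 =>
      have : X * P 0 = P 1 + β 0 • P 0 := by
        rw [hP1, hP0, smul_eq_C_mul]; ring
      rw [this]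
      exact add_mem (hm _) (Submodule.smul_mem _ _ (hm _))
    | 1 =>
      have : X * P 1 = P 2 + β 1 • P 1 + α 1 • P 0 := by
        rw [hP2, hP0, smul_eq_C_mul, smul_eq_C_mul]; ring
      rw [this]
      exact add_mem (add_mem (hm _) (Submodule.smul_mem _ _ (hm _)))
        (Submodule.smul_mem _ _ (hm _))
    | n + 2 =>
      have : X * P (n + 2) = P (n + 3) + β (n + 2) • P (n + 2) + α (n + 2) • P (n + 1)
          + γ (n + 1) • P n := by
        rw [hPrec, smul_eq_C_mul, smul_eq_C_mul, smul_eq_C_mul]; ring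
      rw [this]
      exact add_mem (add_mem (add_mem (hm _) (Submodule.smul_mem _ _ (hm _)))
        (Submodule.smul_mem _ _ (hm _))) (Submodule.smul_mem _ _ (hm _))
  have hXq : ∀ q ∈ Submodule.span ℂ (Set.range P), X * q ∈ Submodule.span ℂ (Set.range P) := by
    intro q hq
    induction hq using Submodule.span_induction with
    | mem x hx => obtain ⟨n, rfl⟩ := hx; exact hX n
    | zero => simp
    | add x y _ _ hx hy => rw [mul_add]; exact add_mem hx hy
    | smul a x _ hx => rw [mul_smul_comm]; exact Submodule.smul_mem _ _ hx
  have hpow : ∀ k : ℕ, (X : ℂ[X]) ^ k ∈ Submodule.span ℂ (Set.range P) := by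
    intro k
    induction k with
    | zero => rw [pow_zero, ← hP0]; exact Submodule.subset_span ⟨0, rfl⟩
    | succ k ih => rw [pow_succ']; exact hXq _ ih
  have hall : p ∈ Submodule.span ℂ (Set.range P) := by
    induction p using Polynomial.induction_on' with
    | add p q hp hq => exact add_mem hp hq
    | monomial n a =>
      rw [← C_mul_X_pow_eq_monomial, ← smul_eq_C_mul]
      exact Submodule.smul_mem _ _ (hpow n)
  induction hall using Submodule.span_induction with
  | mem x hx => obtain ⟨n, rfl⟩ := hx; exact h n
  | zero => simp
  | add x y _ _ hx hy => rw [map_add, map_add, hx, hy]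
  | smul a x _ hx => rw [map_smul, map_smul, hx]

/-- a two-orthogonal MPS admitting a lowering operator `J` of order one
(with `J(P_{n+1}) = λ_{n+1}^{[1]} P_n`) is two-classical: the pair `(u_0,u_1)` satisfies
`D(φ_{1,1}u_0 + φ_{1,2}u_1) + u_1 = 0` and
`D(φ_{2,1}u_0 + φ_{2,2}u_1) + (2/γ_1)(x−β_0)u_0 − (2α_1/γ_1)u_1 = 0`. -/
theorem two_orthogonal_lowering_two_classical
    (β α γ : ℕ → ℂ) (P : ℕ → ℂ[X])
    (hP0 : P 0 = 1) (hP1 : P 1 = X - C (β 0))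
    (hP2 : P 2 = (X - C (β 1)) * (P 1) - C (α 1))
    (hPrec : ∀ n : ℕ, P (n + 3) =
      (X - C (β (n + 2))) * P (n + 2) - C (α (n + 2)) * P (n + 1) - C (γ (n + 1)) * P n)
    (hγ : ∀ n : ℕ, γ (n + 1) ≠ 0)
    (u : ℕ → Module.Dual ℂ ℂ[X])
    (hu : ∀ n m : ℕ, u n (P m) = if n = m then 1 else 0)
    (hdual0 : lmulD X (u 0) = β 0 • u 0 + α 1 • u 1 + γ 1 • u 2)
    (hdual : ∀ n : ℕ, lmulD X (u (n + 1)) =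
      u n + β (n + 1) • u (n + 1) + α (n + 2) • u (n + 2) + γ (n + 2) • u (n + 3))
    (c1 c02 c12 : ℂ)
    (hlam : ∀ n : ℕ, lam1 c1 c12 (n + 1) ≠ 0)
    (hJ : ∀ n : ℕ,
      C c1 * derivative (P (n + 1)) +
        (2 : ℂ)⁻¹ • ((C c02 + C c12 * X) * derivative (derivative (P (n + 1)))) =
      lam1 c1 c12 (n + 1) • P n)
    (E1 A0 B1 F1 E2 A1 : ℂ[X])
    (hE1 : E1 = C (γ 1)⁻¹ * (X - C (β 0)))
    (hA0 : A0 = C (-(α 1) / γ 1))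
    (hB1 : B1 = C (-(α 2) / (γ 1 * γ 2)) * (X - C (β 0)) - C (γ 2)⁻¹)
    (hF1 : F1 = C (γ 2)⁻¹ * (X - C (β 1) + C (α 2 * α 1 / γ 1)))
    (hE2 : E2 = C (γ 3)⁻¹ * ((X - C (β 2)) * E1 - C (α 3) * B1))
    (hA1 : A1 = -(C (γ 3)⁻¹ * (C (α 3) * F1 + 1 + C ((α 1) / γ 1) * (X - C (β 2)))))
    (φ11 φ12 φ21 φ22 : ℂ[X])
    (hφ11 : φ11 = C (2 : ℂ)⁻¹ -
      C (α 1 * lam1 c1 c12 2 / (2 * lam1 c1 c12 1)) * E1 -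
      C (γ 1 * lam1 c1 c12 3 / (2 * lam1 c1 c12 1)) * B1)
    (hφ12 : φ12 = C (2 : ℂ)⁻¹ * (X - C (β 0)) -
      C (α 1 * lam1 c1 c12 2 / (2 * lam1 c1 c12 1)) * A0 -
      C (γ 1 * lam1 c1 c12 3 / (2 * lam1 c1 c12 1)) * F1)
    (hφ21 : φ21 = (X - C (β 1)) * E1 -
      C (α 2 * lam1 c1 c12 3 / lam1 c1 c12 2) * B1 -
      C (γ 2 * lam1 c1 c12 4 / lam1 c1 c12 2) * E2)
    (hφ22 : φ22 = (X - C (β 1)) * A0 -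
      C (α 2 * lam1 c1 c12 3 / lam1 c1 c12 2) * F1 -
      C (γ 2 * lam1 c1 c12 4 / lam1 c1 c12 2) * A1) :
    derD (lmulD φ11 (u 0) + lmulD φ12 (u 1)) + u 1 = 0 ∧
    derD (lmulD φ21 (u 0) + lmulD φ22 (u 1)) +
      lmulD (C (2 / γ 1) * (X - C (β 0))) (u 0) - (2 * α 1 / γ 1) • u 1 = 0 := by
  -- the operator `J` as a linear map, and its transpose on the dual sequence
  have hK : ∀ n p, u n (C c1 * derivative p +
        (2 : ℂ)⁻¹ • ((C c02 + C c12 * X) * derivative (derivative p)))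
        = lam1 c1 c12 (n + 1) * u (n + 1) p := by
    intro n p
    let J : ℂ[X] →ₗ[ℂ] ℂ[X] := LinearMap.mulLeft ℂ (C c1) ∘ₗ derivative +
      (2 : ℂ)⁻¹ • (LinearMap.mulLeft ℂ (C c02 + C c12 * X) ∘ₗ derivative ∘ₗ derivative)
    refine aux_ext β α γ P hP0 hP1 hP2 hPrec (u n ∘ₗ J) (lam1 c1 c12 (n + 1) • u (n + 1)) ?_ p
    intro m
    change u n (C c1 * derivative (P m) + (2 : ℂ)⁻¹ • ((C c02 + C c12 * X) *
      derivative (derivative (P m)))) = lam1 c1 c12 (n + 1) * u (n + 1) (P m)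
    cases m with
    | zero => simp [hP0]; rw [← hP0, hu]; simp
    | succ m =>
      rw [hJ, map_smul, hu, hu]
      by_cases hnm : n = m
      · simp [hnm]
      · simp [hnm]
  have h0 : ∀ p, u 0 (X * p) = β 0 * u 0 p + α 1 * u 1 p + γ 1 * u 2 p :=
    fun p => LinearMap.congr_fun hdual0 p
  have hs : ∀ n p, u (n + 1) (X * p) = u n p + β (n + 1) * u (n + 1) p
      + α (n + 2) * u (n + 2) p + γ (n + 2) * u (n + 3) p :=
    fun n p => LinearMap.congr_fun (hdual n) p
  have hC : ∀ n a p, u n (C a * p) = a * u n p := by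
    intro n a p
    rw [← smul_eq_C_mul, map_smul, smul_eq_mul]
  have g1 := hγ 0
  have g2 := hγ 1
  have g3 := hγ 2
  have l1 := hlam 0
  have l2 := hlam 1
  simp only [zero_add, Nat.reduceAdd] at g1 g2 g3 l1 l2
  have hs0 := hs 0
  have hs1 := hs 1
  have hs2 := hs 2
  have hs3 := hs 3
  simp only [zero_add, Nat.reduceAdd] at hs0 hs1 hs2 hs3
  -- expressions of `u 2`, `u 3`, `u 4` through `u 0`, `u 1`
  have e2 : ∀ q, u 0 (E1 * q) + u 1 (A0 * q) = u 2 q := by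
    intro q
    rw [hE1, hA0, mul_assoc, hC, hC, sub_mul, map_sub, hC, h0]
    field_simp; ring
  have e3 : ∀ q, u 0 (B1 * q) + u 1 (F1 * q) = u 3 q := by
    intro q
    rw [hB1, hF1]
    simp only [mul_assoc, hC, sub_mul, add_mul, map_sub, map_add, h0, hs0]
    field_simp; ring
  have e4 : ∀ q, u 0 (E2 * q) + u 1 (A1 * q) = u 4 q := by
    intro q
    have i1 : E2 * q = C (γ 3)⁻¹ * (E1 * (X * q) - C (β 2) * (E1 * q) - C (α 3) * (B1 * q)) := by
      rw [hE2]; ring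
    have i2 : A1 * q = C (γ 3)⁻¹ * (A0 * (X * q) - C (β 2) * (A0 * q) - C (α 3) * (F1 * q) - q) := by
      have : A0 = - C (α 1 / γ 1) := by rw [hA0, neg_div, C_neg]
      rw [hA1, this]; ring
    rw [i1, i2]
    simp only [hC, map_sub]
    have a := e2 (X * q)
    have b := e2 q
    have c := e3 q
    rw [hs1] at a
    field_simp
    linear_combination a - β 2 * b - α 3 * c
  -- the commutator of `J` with multiplication by `X`
  have hcomm : ∀ n q, u n (C c1 * q) + u n ((C c02 + C c12 * X) * derivative q) =
      lam1 c1 c12 (n + 1) * u (n + 1) (X * q) - u n (X * (C c1 * derivative q +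
        (2 : ℂ)⁻¹ • ((C c02 + C c12 * X) * derivative (derivative q)))) := by
    intro n q
    rw [← hK, ← map_sub, ← map_add]
    congr 1
    have h2 : C (2 : ℂ)⁻¹ * 2 = (1 : ℂ[X]) := by
      rw [show (2 : ℂ[X]) = C 2 from rfl, ← C_mul]; simp
    simp only [derivative_mul, derivative_add, derivative_X, smul_eq_C_mul, one_mul]
    linear_combination (-(C c02 + C c12 * X) * derivative q) * h2
  have hl1 : lam1 c1 c12 1 = c1 := by simp [lam1]
  constructor
  · refine LinearMap.ext fun p => ?_
    change -(u 0 (φ11 * derivative p) + u 1 (φ12 * derivative p)) + u 1 p = 0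
    have hc := hcomm 0 (derivative p)
    have hk := hK 0 p
    rw [h0, hK, hK, hK] at hc
    simp only [zero_add, Nat.reduceAdd, map_add, map_smul, smul_eq_mul, hC] at hc hk
    have i1 : φ11 * derivative p = C (2 : ℂ)⁻¹ * derivative p -
        C (α 1 * lam1 c1 c12 2 / (2 * lam1 c1 c12 1)) * (E1 * derivative p) -
        C (γ 1 * lam1 c1 c12 3 / (2 * lam1 c1 c12 1)) * (B1 * derivative p) := by
      rw [hφ11]; ring
    have i2 : φ12 * derivative p = C (2 : ℂ)⁻¹ * (X * derivative p - C (β 0) * derivative p) -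
        C (α 1 * lam1 c1 c12 2 / (2 * lam1 c1 c12 1)) * (A0 * derivative p) -
        C (γ 1 * lam1 c1 c12 3 / (2 * lam1 c1 c12 1)) * (F1 * derivative p) := by
      rw [hφ12]; ring
    rw [i1, i2]
    simp only [map_sub, hC]
    have a := e2 (derivative p)
    have b := e3 (derivative p)
    generalize lam1 c1 c12 2 = L2 at *
    generalize lam1 c1 c12 3 = L3 at *
    rw [hl1] at l1 hc hk ⊢
    field_simp
    linear_combination hc - 2 * hk + α 1 * L2 * a + γ 1 * L3 * b
  · refine LinearMap.ext fun p => ?_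
    change -(u 0 (φ21 * derivative p) + u 1 (φ22 * derivative p)) +
      u 0 (C (2 / γ 1) * (X - C (β 0)) * p) - (2 * α 1 / γ 1) * u 1 p = 0
    have hc := hcomm 1 (derivative p)
    have hk := hK 1 p
    rw [hs0, hK, hK, hK, hK] at hc
    simp only [zero_add, Nat.reduceAdd, map_add, map_smul, smul_eq_mul, hC] at hc hk
    have i1 : φ21 * derivative p = E1 * (X * derivative p) - C (β 1) * (E1 * derivative p) -
        C (α 2 * lam1 c1 c12 3 / lam1 c1 c12 2) * (B1 * derivative p) -
        C (γ 2 * lam1 c1 c12 4 / lam1 c1 c12 2) * (E2 * derivative p) := by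
      rw [hφ21]; ring
    have i2 : φ22 * derivative p = A0 * (X * derivative p) - C (β 1) * (A0 * derivative p) -
        C (α 2 * lam1 c1 c12 3 / lam1 c1 c12 2) * (F1 * derivative p) -
        C (γ 2 * lam1 c1 c12 4 / lam1 c1 c12 2) * (A1 * derivative p) := by
      rw [hφ22]; ring
    rw [i1, i2]
    have i3 : u 0 (C (2 / γ 1) * (X - C (β 0)) * p) - (2 * α 1 / γ 1) * u 1 p = 2 * u 2 p := by
      rw [mul_assoc, hC, sub_mul, map_sub, hC, h0]
      field_simp; ring
    rw [add_sub_assoc, i3]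
    simp only [map_sub, hC]
    have a := e2 (X * derivative p)
    have b := e2 (derivative p)
    have c := e3 (derivative p)
    have d := e4 (derivative p)
    rw [hl1] at hc
    generalize lam1 c1 c12 2 = L2 at *
    generalize lam1 c1 c12 3 = L3 at *
    generalize lam1 c1 c12 4 = L4 at *
    field_simp
    linear_combination hc - 2 * hk - L2 * a + L2 * β 1 * b + α 2 * L3 * c + γ 2 * L4 * d
end
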